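/- Let 𝔽 be ℝ, ℂ, or ℍ, let 0 < λ₁ < ⋯ < λ_n, let a = diag(λ₁,…,λ_n) ∈ M(n;𝔽), and let f_a : O(n;𝔽) → ℝ be f_a(x) = ‖x − a‖² with respect to the inner product ⟨u,v⟩ = Re Tr(u*v) on M(n;𝔽). Then f_a is a Morse function on O(n;𝔽); its critical points are exactly the matrices σ_I = diag(ε₁,…,ε_n) with ε_j = −1 for j ∈ I and ε_j = 1 otherwise, for I = [i₁ < ⋯ < i_r] ⊆ [1,…,n] (including I = ∅, σ_∅ = I_n); and the index of σ_{i₁,…,i_r} is dim_ℝ𝔽 · (i₁ + ⋯ + i_r) − r. -/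

import Mathlib

open scoped Matrix Quaternion

attribute [local instance] Matrix.frobeniusNormedAddCommGroup Matrix.frobeniusNormedSpace

/-- The set of tangent vectors to a subset `M ⊆ E` at a point `x`. -/
def TangentSetAt {E : Type*} [NormedAddCommGroup E] [NormedSpace ℝ E]
    (M : Set E) (x : E) : Set E :=
  {u | ∃ c : ℝ → E, ContDiff ℝ (⊤ : ℕ∞) c ∧ (∀ t, c t ∈ M) ∧ c 0 = x ∧ deriv c 0 = u}

/-- `x` is a critical point of the restriction of `f` to `M`. -/
def IsCriticalPointOn {E : Type*} [NormedAddCommGroup E] [NormedSpace ℝ E]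
    (M : Set E) (f : E → ℝ) (x : E) : Prop :=
  x ∈ M ∧ ∀ c : ℝ → E, ContDiff ℝ (⊤ : ℕ∞) c → (∀ t, c t ∈ M) → c 0 = x →
    deriv (f ∘ c) 0 = 0

/-- `B` is the Hessian bilinear form of `f|M` at `x`. -/
def IsHessianAt {E : Type*} [NormedAddCommGroup E] [NormedSpace ℝ E]
    (M : Set E) (f : E → ℝ) (x : E) (B : E →ₗ[ℝ] E →ₗ[ℝ] ℝ) : Prop :=
  ∀ c : ℝ → E, ContDiff ℝ (⊤ : ℕ∞) c → (∀ t, c t ∈ M) → c 0 = x →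
    deriv (deriv (f ∘ c)) 0 = B (deriv c 0) (deriv c 0)

/-- Non-degeneracy of a critical point of `f|M`. -/
def IsNondegenerateCriticalPointOn {E : Type*} [NormedAddCommGroup E] [NormedSpace ℝ E]
    (M : Set E) (f : E → ℝ) (x : E) : Prop :=
  IsCriticalPointOn M f x ∧ ∃ B : E →ₗ[ℝ] E →ₗ[ℝ] ℝ, IsHessianAt M f x B ∧
    ∀ u ∈ TangentSetAt M x, (∀ w ∈ TangentSetAt M x, B u w = 0) → u = 0

/-- `f` is a Morse function on `M`. -/
def IsMorseOn {E : Type*} [NormedAddCommGroup E] [NormedSpace ℝ E]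
    (M : Set E) (f : E → ℝ) : Prop :=
  ∀ x, IsCriticalPointOn M f x → IsNondegenerateCriticalPointOn M f x

/-- The critical point `x` of `f|M` has index `r`. -/
def HasIndexAt {E : Type*} [NormedAddCommGroup E] [NormedSpace ℝ E]
    (M : Set E) (f : E → ℝ) (x : E) (r : ℕ) : Prop :=
  ∃ B : E →ₗ[ℝ] E →ₗ[ℝ] ℝ, IsHessianAt M f x B ∧
    (∃ V : Submodule ℝ E, (V : Set E) ⊆ TangentSetAt M x ∧ Module.finrank ℝ V = r ∧
      ∀ u ∈ V, u ≠ 0 → B u u < 0) ∧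
    (∀ W : Submodule ℝ E, (W : Set E) ⊆ TangentSetAt M x → (∀ u ∈ W, u ≠ 0 → B u u < 0) →
      Module.finrank ℝ W ≤ r)

/-- `O(n;𝔽) = {x : x*x = 1}`: the orthogonal / unitary / symplectic group. -/
def OrthSet (𝔽 : Type*) [Ring 𝔽] [StarRing 𝔽] (n : ℕ) : Set (Matrix (Fin n) (Fin n) 𝔽) :=
  {x | xᴴ * x = 1}

/-- The statement of Theorem 3 of the paper for the group `O(n;𝔽)`, where `d = dim_ℝ 𝔽` and
`toF : ℝ → 𝔽` is the canonical inclusion: `f_a(x) = ‖x − a‖²` (`a = diag(λ₁,…,λ_n)`) is a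
Morse function on `O(n;𝔽)`, its critical points are exactly the matrices `σ_I`, and the
index of `σ_I`, `I = [i₁ < ⋯ < i_r]`, is `d·(i₁ + ⋯ + i_r) − r`. -/
def OrthMorseStatement (𝔽 : Type*) [NormedRing 𝔽] [StarRing 𝔽] [NormedSpace ℝ 𝔽]
    (d n : ℕ) (toF : ℝ → 𝔽) (l : Fin n → ℝ) : Prop :=
  IsMorseOn (OrthSet 𝔽 n)
    (fun y => ‖y - Matrix.diagonal (fun i => toF (l i))‖ ^ 2) ∧
  {x | IsCriticalPointOn (OrthSet 𝔽 n)
      (fun y => ‖y - Matrix.diagonal (fun i => toF (l i))‖ ^ 2) x} =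
    {x | ∃ I : Finset (Fin n),
      x = Matrix.diagonal (fun j => if j ∈ I then (-1 : 𝔽) else 1)} ∧
  ∀ I : Finset (Fin n),
    HasIndexAt (OrthSet 𝔽 n)
      (fun y => ‖y - Matrix.diagonal (fun i => toF (l i))‖ ^ 2)
      (Matrix.diagonal (fun j => if j ∈ I then (-1 : 𝔽) else 1))
      (d * (∑ j ∈ I, ((j : ℕ) + 1)) - I.card)

theorem hasDerivAt_linearMap_comp {E F : Type*} [NormedAddCommGroup E] [NormedSpace ℝ E]
    [FiniteDimensional ℝ E] [NormedAddCommGroup F] [NormedSpace ℝ F] (φ : E →ₗ[ℝ] F)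
    {c : ℝ → E} {c' : E} {t : ℝ} (h : HasDerivAt c c' t) :
    HasDerivAt (fun s => φ (c s)) (φ c') t :=
  (LinearMap.toContinuousLinearMap φ).hasFDerivAt.comp_hasDerivAt t h

theorem hasDerivAt_linearMap_exp {A E : Type*} [NormedRing A] [NormedAlgebra ℝ A]
    [FiniteDimensional ℝ A] [NormedAddCommGroup E] [NormedSpace ℝ E] (φ : A →ₗ[ℝ] E) (ξ : A) :
    ContDiff ℝ (⊤ : ℕ∞) (fun t : ℝ => φ (NormedSpace.exp (t • ξ))) ∧
      HasDerivAt (fun t : ℝ => φ (NormedSpace.exp (t • ξ))) (φ ξ) 0 := by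
  have : CompleteSpace A := FiniteDimensional.complete ℝ A
  constructor
  · have h : ContDiff ℝ (⊤ : ℕ∞) (NormedSpace.exp : A → A) :=
      contDiff_iff_contDiffAt.2 fun x => (NormedSpace.exp_analytic (𝕂 := ℝ) x).contDiffAt
    exact (LinearMap.toContinuousLinearMap φ).contDiff.comp
      (h.comp (contDiff_id.smul contDiff_const))
  · refine hasDerivAt_linearMap_comp φ ?_
    simpa using hasDerivAt_exp_smul_const (𝕂 := ℝ) ξ (0 : ℝ)

theorem ContDiff.hasDerivAt_deriv {E : Type*} [NormedAddCommGroup E] [NormedSpace ℝ E] {c : ℝ → E}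
    (hc : ContDiff ℝ (⊤ : ℕ∞) c) (t : ℝ) : HasDerivAt c (deriv c t) t :=
  (hc.differentiable (by simp) t).hasDerivAt

theorem ContDiff.contDiff_deriv {E : Type*} [NormedAddCommGroup E] [NormedSpace ℝ E] {c : ℝ → E}
    (hc : ContDiff ℝ (⊤ : ℕ∞) c) : ContDiff ℝ (⊤ : ℕ∞) (deriv c) :=
  (contDiff_infty_iff_deriv.1 hc).2

theorem mem_orthSet_iff {𝔽 : Type*} [Ring 𝔽] [StarRing 𝔽] {n : ℕ} {x : Matrix (Fin n) (Fin n) 𝔽} :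
    x ∈ OrthSet 𝔽 n ↔ ∀ i j, ∑ k, star (x k i) * x k j = if i = j then 1 else 0 := by
  simp [OrthSet, ← Matrix.ext_iff, Matrix.mul_apply, Matrix.one_apply]

/-- A finite-dimensional real normed star-algebra (such as `ℝ`, `ℂ`, `ℍ`) with a real part `re`
satisfying `x + x* = 2 re x` and `x* x = ‖x‖²`. -/
class RealPartAlgebra (𝔽 : Type*) [NormedRing 𝔽] [NormedAlgebra ℝ 𝔽] [StarRing 𝔽] : Type _
    extends StarModule ℝ 𝔽, NormedStarGroup 𝔽, FiniteDimensional ℝ 𝔽, Nontrivial 𝔽 where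
  /-- The real part. -/
  re : 𝔽 →ₗ[ℝ] ℝ
  add_star : ∀ x : 𝔽, x + star x = algebraMap ℝ 𝔽 (2 * re x)
  star_mul_self : ∀ x : 𝔽, star x * x = algebraMap ℝ 𝔽 (‖x‖ ^ 2)

namespace RealPartAlgebra

variable {𝔽 : Type*} [NormedRing 𝔽] [NormedAlgebra ℝ 𝔽] [StarRing 𝔽] [RealPartAlgebra 𝔽]

theorem re_star (x : 𝔽) : re (star x) = re x := by
  have h := (add_star (star x)).symm.trans ((by rw [star_star, add_comm, add_star x]))
  have := (algebraMap ℝ 𝔽).injective h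
  linarith

theorem re_algebraMap (r : ℝ) : re (algebraMap ℝ 𝔽 r) = r := by
  have h := add_star (algebraMap ℝ 𝔽 r)
  rw [← algebraMap_star_comm, ← map_add] at h
  have := (algebraMap ℝ 𝔽).injective h
  simp only [star_trivial] at this
  linarith

theorem re_star_mul_self (x : 𝔽) : re (star x * x) = ‖x‖ ^ 2 := by
  rw [star_mul_self, re_algebraMap]

theorem re_star_mul_comm (x y : 𝔽) : re (star x * y) = re (star y * x) := by
  rw [← re_star, star_mul, star_star]

theorem re_mul_comm (x y : 𝔽) : re (x * y) = re (y * x) := by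
  have h₁ := re_star_mul_self (star x + y)
  have h₂ := re_star_mul_self (x + star y)
  have h₃ : ‖star x + y‖ = ‖x + star y‖ := by rw [← norm_star (x + star y)]; simp
  have h₄ := re_star_mul_self (star x)
  have h₅ := re_star_mul_self (star y)
  have h₆ := re_star_mul_self x
  have h₇ := re_star_mul_self y
  have h₈ := re_star_mul_comm x (star y)
  have h₉ := re_star_mul_comm (star x) y
  simp only [star_add, star_star, mul_add, add_mul, map_add, norm_star] at *
  rw [h₃] at h₁
  linarith

theorem norm_sub_algebraMap_sq (x : 𝔽) (r : ℝ) :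
    ‖x - algebraMap ℝ 𝔽 r‖ ^ 2 = ‖x‖ ^ 2 - 2 * (r * re x) + r ^ 2 := by
  rw [← re_star_mul_self, ← re_star_mul_self x]
  have : star (x - algebraMap ℝ 𝔽 r) * (x - algebraMap ℝ 𝔽 r) =
      star x * x - r • (star x) - r • x + algebraMap ℝ 𝔽 (r ^ 2) := by
    rw [star_sub, ← algebraMap_star_comm, star_trivial r, sub_mul, mul_sub, mul_sub,
      ← Algebra.commutes r (star x), Algebra.smul_def, Algebra.smul_def, pow_two, map_mul]
    abel
  rw [this]
  simp only [map_add, map_sub, map_smul, re_algebraMap, re_star, smul_eq_mul]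
  ring

theorem add_star_eq_zero_iff (x : 𝔽) : x + star x = 0 ↔ re x = 0 := by
  rw [add_star, FaithfulSMul.algebraMap_eq_zero_iff ℝ 𝔽]
  simp

theorem finrank_ker_re : Module.finrank ℝ (LinearMap.ker (re : 𝔽 →ₗ[ℝ] ℝ)) + 1 =
    Module.finrank ℝ 𝔽 := by
  have h := LinearMap.finrank_range_add_finrank_ker (re : 𝔽 →ₗ[ℝ] ℝ)
  rw [LinearMap.range_eq_top.2 fun r => ⟨_, re_algebraMap r⟩] at h
  simp at h
  omega

noncomputable instance : RealPartAlgebra ℝ where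
  re := LinearMap.id
  add_star x := by simp [two_mul]
  star_mul_self x := by simp [pow_two]

noncomputable instance : RealPartAlgebra ℂ where
  re := Complex.reLm
  add_star x := by simp [Complex.ext_iff, two_mul]
  star_mul_self x := by simp [Complex.conj_mul']

noncomputable instance : RealPartAlgebra ℍ[ℝ] where
  star_smul r x := by ext <;> simp
  norm_star_le x := (norm_star x).le
  re := QuaternionAlgebra.reₗ _ _ _
  add_star x := by simpa using! Quaternion.self_add_star' x
  star_mul_self x := by
    rw [Quaternion.star_mul_self, Quaternion.normSq_eq_norm_mul_self, ← pow_two]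
    rfl

/-- The real part of the `(i,i)` entries of `x`, weighted by `l`: this is `Re Tr(ax)`. -/
noncomputable def weightedTrace {n : ℕ} (l : Fin n → ℝ) : Matrix (Fin n) (Fin n) 𝔽 →ₗ[ℝ] ℝ :=
  ∑ i, l i • (re ∘ₗ Matrix.entryLinearMap ℝ 𝔽 i i)

theorem weightedTrace_apply {n : ℕ} (l : Fin n → ℝ) (x : Matrix (Fin n) (Fin n) 𝔽) :
    weightedTrace l x = ∑ i, l i * re (x i i) := by
  simp [weightedTrace]

theorem sum_norm_sq_col_of_mem_orthSet {n : ℕ} {x : Matrix (Fin n) (Fin n) 𝔽}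
    (hx : x ∈ OrthSet 𝔽 n) (j : Fin n) : ∑ k, ‖x k j‖ ^ 2 = 1 := by
  have := congrArg re (mem_orthSet_iff.1 hx j j)
  simpa [re_star_mul_self, ← (algebraMap ℝ 𝔽).map_one, re_algebraMap,
    -map_one] using this

theorem norm_sub_diagonal_sq {n : ℕ} {x : Matrix (Fin n) (Fin n) 𝔽}
    (hx : x ∈ OrthSet 𝔽 n) (l : Fin n → ℝ) :
    ‖x - Matrix.diagonal (fun i => algebraMap ℝ 𝔽 (l i))‖ ^ 2 =
      (n + ∑ i, l i ^ 2) - 2 * weightedTrace l x := by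
  have h : ∀ A : Matrix (Fin n) (Fin n) 𝔽, ‖A‖ ^ 2 = ∑ j, ∑ i, ‖A i j‖ ^ 2 := fun A => by
    rw [Matrix.frobenius_norm_def, ← Real.rpow_natCast, ← Real.rpow_mul (by positivity),
      Finset.sum_comm]
    simp
  have h' : ∀ i j, ‖(x - Matrix.diagonal (fun i => algebraMap ℝ 𝔽 (l i))) i j‖ ^ 2 =
      ‖x i j‖ ^ 2 + if i = j then (l j ^ 2 - 2 * (l j * re (x j j))) else 0 := by
    intro i j
    by_cases hij : i = j
    · subst hij
      simp [norm_sub_algebraMap_sq]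
      ring
    · simp [hij]
  simp only [h, h', Finset.sum_add_distrib, sum_norm_sq_col_of_mem_orthSet hx,
    weightedTrace_apply, Finset.mul_sum]
  simp
  ring

section Curves

variable {n : ℕ} {c : ℝ → Matrix (Fin n) (Fin n) 𝔽}

theorem hasDerivAt_entry (hc : ContDiff ℝ (⊤ : ℕ∞) c) (i j : Fin n) (t : ℝ) :
    HasDerivAt (fun s => c s i j) (deriv c t i j) t :=
  hasDerivAt_linearMap_comp (Matrix.entryLinearMap ℝ 𝔽 i j) (hc.hasDerivAt_deriv t)

theorem deriv_distSq_comp (hc : ContDiff ℝ (⊤ : ℕ∞) c) (hM : ∀ t, c t ∈ OrthSet 𝔽 n)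
    (l : Fin n → ℝ) :
    deriv ((fun y => ‖y - Matrix.diagonal (fun i => algebraMap ℝ 𝔽 (l i))‖ ^ 2) ∘ c) =
      fun t => -2 * weightedTrace l (deriv c t) := by
  have h : ((fun y => ‖y - Matrix.diagonal (fun i => algebraMap ℝ 𝔽 (l i))‖ ^ 2) ∘ c) =
      fun t => (n + ∑ i, l i ^ 2) - 2 * weightedTrace l (c t) :=
    funext fun t => norm_sub_diagonal_sq (hM t) l
  rw [h]
  funext t
  exact (((hasDerivAt_linearMap_comp (weightedTrace l)
    (hc.hasDerivAt_deriv t)).const_mul 2).const_sub _).deriv.trans (neg_mul _ _).symm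

theorem deriv_deriv_distSq_comp (hc : ContDiff ℝ (⊤ : ℕ∞) c) (hM : ∀ t, c t ∈ OrthSet 𝔽 n)
    (l : Fin n → ℝ) (t : ℝ) :
    deriv (deriv ((fun y => ‖y - Matrix.diagonal (fun i => algebraMap ℝ 𝔽 (l i))‖ ^ 2) ∘ c)) t =
      -2 * weightedTrace l (deriv (deriv c) t) := by
  rw [deriv_distSq_comp hc hM]
  exact ((hasDerivAt_linearMap_comp (weightedTrace l)
    (hc.contDiff_deriv.hasDerivAt_deriv t)).const_mul (-2)).deriv

theorem sum_star_deriv_mul_add (hc : ContDiff ℝ (⊤ : ℕ∞) c) (hM : ∀ t, c t ∈ OrthSet 𝔽 n)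
    (t : ℝ) (i j : Fin n) :
    ∑ k, (star (deriv c t k i) * c t k j + star (c t k i) * deriv c t k j) = 0 := by
  have h : HasDerivAt (fun s => ∑ k, star (c s k i) * c s k j)
      (∑ k, (star (deriv c t k i) * c t k j + star (c t k i) * deriv c t k j)) t :=
    HasDerivAt.fun_sum fun k _ => (hasDerivAt_entry hc k i t).star.mul (hasDerivAt_entry hc k j t)
  simp only [fun s => mem_orthSet_iff.1 (hM s) i j] at h
  exact h.unique (hasDerivAt_const t _)

theorem sum_re_star_mul_deriv_deriv (hc : ContDiff ℝ (⊤ : ℕ∞) c) (hM : ∀ t, c t ∈ OrthSet 𝔽 n)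
    (t : ℝ) (j : Fin n) :
    ∑ k, re (star (c t k j) * deriv (deriv c) t k j) = -∑ k, ‖deriv c t k j‖ ^ 2 := by
  have h₀ : ∀ s, ∑ k, re (star (c s k j) * deriv c s k j) = 0 := fun s => by
    have := congrArg re (sum_star_deriv_mul_add hc hM s j j)
    simp only [map_sum, map_add, map_zero, re_star_mul_comm (deriv c s _ j), ← two_mul,
      ← Finset.mul_sum] at this
    linarith
  have h : HasDerivAt (fun s => ∑ k, re (star (c s k j) * deriv c s k j))
      (∑ k, re (star (deriv c t k j) * deriv c t k j + star (c t k j) * deriv (deriv c) t k j)) t :=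
    HasDerivAt.fun_sum fun k _ => hasDerivAt_linearMap_comp re <|
      (hasDerivAt_entry hc k j t).star.mul (hasDerivAt_entry hc.contDiff_deriv k j t)
  simp only [h₀] at h
  have := h.unique (hasDerivAt_const t _)
  simp only [map_add, re_star_mul_self, Finset.sum_add_distrib] at this
  linarith

end Curves

theorem mul_mem_tangentSetAt {n : ℕ} {x ξ : Matrix (Fin n) (Fin n) 𝔽} (hx : x ∈ OrthSet 𝔽 n)
    (hξ : ξᴴ = -ξ) : x * ξ ∈ TangentSetAt (OrthSet 𝔽 n) x := by
  let _ : NormedAlgebra ℚ 𝔽 := NormedAlgebra.restrictScalars ℚ ℝ 𝔽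
  have : CompleteSpace 𝔽 := FiniteDimensional.complete ℝ 𝔽
  obtain ⟨h₁, h₂⟩ := @hasDerivAt_linearMap_exp (Matrix (Fin n) (Fin n) 𝔽)
    (Matrix (Fin n) (Fin n) 𝔽) Matrix.linftyOpNormedRing Matrix.linftyOpNormedAlgebra
    (inferInstanceAs (FiniteDimensional ℝ (Matrix (Fin n) (Fin n) 𝔽))) _ _
    (LinearMap.mulLeft ℝ x) ξ
  refine ⟨_, h₁, fun t => ?_, ?_, h₂.deriv⟩
  · have h : (NormedSpace.exp (t • ξ))ᴴ * NormedSpace.exp (t • ξ) = 1 := by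
      rw [← Matrix.exp_conjTranspose, ← Matrix.exp_add_of_commute]
      · simp [Matrix.conjTranspose_smul, hξ]
      · simp [Matrix.conjTranspose_smul, hξ]
    change (x * NormedSpace.exp (t • ξ))ᴴ * (x * NormedSpace.exp (t • ξ)) = 1
    rw [Matrix.conjTranspose_mul, Matrix.mul_assoc, ← Matrix.mul_assoc xᴴ, show xᴴ * x = 1 from hx,
      Matrix.one_mul, h]
  · change x * NormedSpace.exp ((0 : ℝ) • ξ) = x
    simp

theorem exists_signs_of_isCriticalPointOn {n : ℕ} {l : Fin n → ℝ} (hpos : ∀ i, 0 < l i)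
    (hinj : Function.Injective l) {x : Matrix (Fin n) (Fin n) 𝔽}
    (hx : IsCriticalPointOn (OrthSet 𝔽 n)
      (fun y => ‖y - Matrix.diagonal (fun i => algebraMap ℝ 𝔽 (l i))‖ ^ 2) x) :
    ∃ I : Finset (Fin n), x = Matrix.diagonal (fun j => if j ∈ I then (-1 : 𝔽) else 1) := by
  obtain ⟨hxO, hcrit⟩ := hx
  have hL : ∀ ξ : Matrix (Fin n) (Fin n) 𝔽, ξᴴ = -ξ → weightedTrace l (x * ξ) = 0 := by
    intro ξ hξ
    obtain ⟨c, hc, hM, h₀, h₁⟩ := mul_mem_tangentSetAt hxO hξ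
    have h := hcrit c hc hM h₀
    rw [deriv_distSq_comp hc hM] at h
    have h' : -2 * weightedTrace l (x * ξ) = 0 := by rw [← h₁]; exact h
    simpa using h'
  set a : Matrix (Fin n) (Fin n) 𝔽 := Matrix.diagonal (fun i => algebraMap ℝ 𝔽 (l i)) with ha
  have haH : aᴴ = a := by
    simp only [ha, Matrix.diagonal_conjTranspose]
    congr 1
    funext i
    simp [← algebraMap_star_comm]
  set m := a * x with hm
  have hmapp : ∀ i j, m i j = l i • x i j := fun i j => by
    simp [hm, ha, Matrix.diagonal_mul, Algebra.smul_def]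
  have hherm : mᴴ = m := by
    set ξ := m - mᴴ with hξdef
    have hξ : ξᴴ = -ξ := by simp [hξdef]
    have hξ' : ∀ i j, star (ξ i j) = -ξ j i := fun i j => congrFun (congrFun hξ j) i
    have hS : ∑ i, ∑ k, re (m i k * ξ k i) = 0 := by
      rw [← hL ξ hξ, weightedTrace_apply]
      refine Finset.sum_congr rfl fun i _ => ?_
      simp [Matrix.mul_apply, hmapp, Finset.mul_sum]
    have hpt : ∀ k i, ‖ξ k i‖ ^ 2 = -re (m k i * ξ i k) - re (m i k * ξ k i) := by
      intro k i
      have e₁ : re (star (ξ k i) * m k i) = -re (m k i * ξ i k) := by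
        rw [hξ', re_mul_comm]; simp
      have e₂ : re (star (ξ k i) * star (m i k)) = re (m i k * ξ k i) := by
        rw [← star_mul, re_star]
      rw [← re_star_mul_self]
      nth_rewrite 2 [hξdef]
      rw [Matrix.sub_apply, mul_sub, map_sub, Matrix.conjTranspose_apply, e₁, e₂]
    have hsum : ∑ k, ∑ i, ‖ξ k i‖ ^ 2 = 0 := by
      simp only [hpt, Finset.sum_sub_distrib, Finset.sum_neg_distrib, hS]
      rw [Finset.sum_comm, hS]
      simp
    have hzero : ξ = 0 := by
      ext k i
      rw [Finset.sum_eq_zero_iff_of_nonneg fun _ _ => by positivity] at hsum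
      have := hsum k (Finset.mem_univ _)
      rw [Finset.sum_eq_zero_iff_of_nonneg fun _ _ => by positivity] at this
      simpa using this i (Finset.mem_univ _)
    exact (sub_eq_zero.1 hzero).symm
  have hxx : x * xᴴ = 1 := by
    have : IsArtinianRing (Matrix (Fin n) (Fin n) 𝔽) := IsArtinianRing.of_finite ℝ _
    exact mul_eq_one_symm hxO
  have hsq : m * m = a * a := by
    nth_rewrite 2 [← hherm]
    rw [hm, Matrix.conjTranspose_mul, haH, ← Matrix.mul_assoc, Matrix.mul_assoc a, hxx,
      Matrix.mul_one]
  have hdiag : ∀ i j, i ≠ j → x i j = 0 := by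
    intro i j hij
    have hcomm : a * a * m = m * (a * a) := by rw [← hsq, Matrix.mul_assoc]
    have h := congrFun (congrFun hcomm i) j
    simp only [ha, Matrix.diagonal_mul_diagonal, Matrix.diagonal_mul, Matrix.mul_diagonal,
      ← map_mul] at h
    rw [← Algebra.commutes, ← Algebra.smul_def, ← Algebra.smul_def, ← sub_eq_zero, ← sub_smul,
      hmapp, smul_smul, smul_eq_zero] at h
    refine h.resolve_left (mul_ne_zero (fun h0 => hij (hinj ?_)) (hpos i).ne')
    nlinarith [hpos i, hpos j, mul_self_eq_mul_self_iff.1 (sub_eq_zero.1 h0)]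
  have hreal : ∀ i, x i i = algebraMap ℝ 𝔽 (re (x i i)) := by
    intro i
    have h := congrFun (congrFun hherm i) i
    rw [Matrix.conjTranspose_apply, hmapp, star_smul, star_trivial] at h
    have h' : star (x i i) = x i i := smul_right_injective 𝔽 (hpos i).ne' h
    have h₂ := add_star (x i i)
    rw [h', ← two_smul ℝ, map_mul, ← Algebra.smul_def] at h₂
    exact smul_right_injective 𝔽 two_ne_zero h₂
  have hone : ∀ i, re (x i i) = 1 ∨ re (x i i) = -1 := by
    intro i
    have h := sum_norm_sq_col_of_mem_orthSet hxO i
    rw [Finset.sum_eq_single i (fun k _ hk => by simp [hdiag k i hk]) (by simp),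
      ← re_star_mul_self, hreal, ← algebraMap_star_comm, star_trivial, ← map_mul,
      re_algebraMap] at h
    exact mul_self_eq_one_iff.1 h
  refine ⟨Finset.univ.filter fun i => re (x i i) = -1, ?_⟩
  ext i j
  by_cases hij : i = j
  · subst hij
    rw [hreal]
    rcases hone i with h | h <;> norm_num [h]
  · simp [hdiag i j hij, hij]

/-- The sign vector with `-1` at the indices in `I` and `1` elsewhere. -/
def signs {n : ℕ} (I : Finset (Fin n)) (j : Fin n) : ℝ := if j ∈ I then -1 else 1

theorem diagonal_signs {𝔽 : Type*} [Ring 𝔽] [Algebra ℝ 𝔽] {n : ℕ} (I : Finset (Fin n)) :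
    Matrix.diagonal (fun j => algebraMap ℝ 𝔽 (signs I j)) =
    Matrix.diagonal (fun j => if j ∈ I then (-1 : 𝔽) else 1) := by
  congr 1
  funext j
  unfold signs
  split_ifs <;> simp

section Signs

variable {n : ℕ} (I : Finset (Fin n))

theorem signs_mul_self (j : Fin n) : signs I j * signs I j = 1 := by
  unfold signs; split_ifs <;> norm_num

theorem signs_ne_zero (j : Fin n) : signs I j ≠ 0 :=
  left_ne_zero_of_mul_eq_one (signs_mul_self I j)

theorem signs_max_mul_pos {l : Fin n → ℝ} (hpos : ∀ i, 0 < l i) (hmono : StrictMono l)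
    (i k : Fin n) : 0 < signs I (max k i) * (l i * signs I i + l k * signs I k) := by
  have hi := hpos i
  have hk := hpos k
  rcases lt_trichotomy i k with h | rfl | h
  · have := hmono h
    rw [max_eq_left h.le]
    unfold signs
    split_ifs <;> linarith
  · rw [max_self]
    unfold signs
    split_ifs <;> linarith
  · have := hmono h
    rw [max_eq_right h.le]
    unfold signs
    split_ifs <;> linarith

theorem diagonal_signs_mem_orthSet :
    Matrix.diagonal (fun j => algebraMap ℝ 𝔽 (signs I j)) ∈ OrthSet 𝔽 n := by
  change _ * _ = _
  rw [Matrix.diagonal_conjTranspose, Matrix.diagonal_mul_diagonal, ← Matrix.diagonal_one]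
  congr 1
  funext j
  simp [← algebraMap_star_comm, ← map_mul, signs_mul_self]

/-- The tangent space of `OrthSet 𝔽 n` at the diagonal matrix with entries `signs I`. -/
def tangentSpace (𝔽 : Type*) [NormedRing 𝔽] [NormedAlgebra ℝ 𝔽] [StarRing 𝔽]
    [RealPartAlgebra 𝔽] {n : ℕ} (I : Finset (Fin n)) :
    Submodule ℝ (Matrix (Fin n) (Fin n) 𝔽) where
  carrier := {u | ∀ i j, signs I i • u i j = -(signs I j • star (u j i))}
  add_mem' {u v} hu hv i j := by
    simp only [Matrix.add_apply, smul_add, star_add, hu i j, hv i j, neg_add]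
  zero_mem' i j := by simp
  smul_mem' r u hu i j := by
    simp only [Matrix.smul_apply, star_smul, star_trivial]
    rw [smul_comm, hu i j, smul_neg, smul_comm]

theorem tangentSetAt_diagonal_signs :
    TangentSetAt (OrthSet 𝔽 n) (Matrix.diagonal (fun j => algebraMap ℝ 𝔽 (signs I j))) =
      tangentSpace 𝔽 I := by
  ext u
  constructor
  · rintro ⟨c, hc, hM, h₀, h₁⟩ i j
    have h := sum_star_deriv_mul_add hc hM 0 i j
    rw [h₀, Finset.sum_add_distrib, Finset.sum_eq_single j (by simp +contextual) (by simp),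
      Finset.sum_eq_single i (by simp +contextual) (by simp), Matrix.diagonal_apply_eq,
      Matrix.diagonal_apply_eq, ← algebraMap_star_comm, star_trivial (signs I i), ← Algebra.commutes,
      ← Algebra.smul_def, ← Algebra.smul_def] at h
    rw [← h₁]
    exact eq_neg_of_add_eq_zero_right h
  · intro hu
    set s : Matrix (Fin n) (Fin n) 𝔽 := Matrix.diagonal (fun j => algebraMap ℝ 𝔽 (signs I j))
      with hs
    have hξ : (s * u)ᴴ = -(s * u) := by
      ext i j
      have := hu i j
      simp only [hs, Matrix.conjTranspose_apply, Matrix.neg_apply, Matrix.diagonal_mul,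
        ← Algebra.smul_def, star_smul, star_trivial, this, neg_neg]
    have hss : s * (s * u) = u := by
      rw [← Matrix.mul_assoc, hs, Matrix.diagonal_mul_diagonal]
      simp [← map_mul, signs_mul_self]
    have := mul_mem_tangentSetAt (diagonal_signs_mem_orthSet (𝔽 := 𝔽) I) hξ
    rwa [← hs, hss] at this

theorem norm_apply_comm_of_mem_tangentSpace {u : Matrix (Fin n) (Fin n) 𝔽}
    (hu : u ∈ tangentSpace 𝔽 I) (i k : Fin n) : ‖u i k‖ = ‖u k i‖ := by
  have h := congrArg norm (hu i k)
  have hs : ∀ j, ‖signs I j‖ = 1 := fun j => by unfold signs; split_ifs <;> simp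
  simpa [norm_smul, hs] using h

theorem re_apply_self_of_mem_tangentSpace {u : Matrix (Fin n) (Fin n) 𝔽}
    (hu : u ∈ tangentSpace 𝔽 I) (i : Fin n) : re (u i i) = 0 := by
  have h := hu i i
  rw [← smul_neg] at h
  exact (add_star_eq_zero_iff _).1 <|
    eq_neg_iff_add_eq_zero.1 <| smul_right_injective 𝔽 (signs_ne_zero I i) h

/-- The Hessian at `diagonal (signs I)` of the distance function to `diagonal l`. -/
noncomputable def hessian (𝔽 : Type*) [NormedRing 𝔽] [NormedAlgebra ℝ 𝔽] [StarRing 𝔽]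
    [RealPartAlgebra 𝔽] {n : ℕ} (I : Finset (Fin n)) (l : Fin n → ℝ) :
    Matrix (Fin n) (Fin n) 𝔽 →ₗ[ℝ] Matrix (Fin n) (Fin n) 𝔽 →ₗ[ℝ] ℝ :=
  LinearMap.mk₂ ℝ (fun u v => 2 * ∑ i, ∑ k, l i * signs I i * re (star (u k i) * v k i))
    (fun u u' v => by
      simp only [Matrix.add_apply, star_add, add_mul, map_add, mul_add, Finset.sum_add_distrib])
    (fun r u v => by
      simp only [Matrix.smul_apply, star_smul, star_trivial, smul_mul_assoc, map_smul,
        smul_eq_mul, Finset.mul_sum]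
      exact Finset.sum_congr rfl fun _ _ => Finset.sum_congr rfl fun _ _ => by ring)
    (fun u v v' => by
      simp only [Matrix.add_apply, mul_add, map_add, Finset.sum_add_distrib])
    (fun r u v => by
      simp only [Matrix.smul_apply, mul_smul_comm, map_smul,
        smul_eq_mul, Finset.mul_sum]
      exact Finset.sum_congr rfl fun _ _ => Finset.sum_congr rfl fun _ _ => by ring)

theorem hessian_apply (l : Fin n → ℝ) (u v : Matrix (Fin n) (Fin n) 𝔽) :
    hessian 𝔽 I l u v = 2 * ∑ i, ∑ k, l i * signs I i * re (star (u k i) * v k i) := rfl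

theorem isHessianAt_hessian (l : Fin n → ℝ) :
    IsHessianAt (OrthSet 𝔽 n)
      (fun y => ‖y - Matrix.diagonal (fun i => algebraMap ℝ 𝔽 (l i))‖ ^ 2)
      (Matrix.diagonal (fun j => algebraMap ℝ 𝔽 (signs I j))) (hessian 𝔽 I l) := by
  intro c hc hM h₀
  rw [deriv_deriv_distSq_comp hc hM, hessian_apply, weightedTrace_apply, neg_mul, ← mul_neg,
    ← Finset.sum_neg_distrib]
  congr 1
  refine Finset.sum_congr rfl fun j _ => ?_
  have h := sum_re_star_mul_deriv_deriv hc hM 0 j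
  rw [h₀, Finset.sum_eq_single j (by simp +contextual) (by simp), Matrix.diagonal_apply_eq,
    ← algebraMap_star_comm, star_trivial, ← Algebra.smul_def, map_smul, smul_eq_mul] at h
  simp only [re_star_mul_self, ← Finset.mul_sum]
  have aux : ∀ a s r S : ℝ, s * s = 1 → s * r = -S → -(a * r) = a * s * S := by
    intro a s r S h₁ h₂
    linear_combination (-a * s) * h₂ + a * r * h₁
  exact aux _ _ _ _ (signs_mul_self I j) h

/-- Multiplying the entries of a tangent vector by a symmetric real matrix gives the value of the
Hessian as a sum of squares. -/
theorem hessian_smul_of_mem_tangentSpace (l : Fin n → ℝ) {u v : Matrix (Fin n) (Fin n) 𝔽}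
    (hu : u ∈ tangentSpace 𝔽 I) {s : Fin n → Fin n → ℝ} (hs : ∀ i k, s i k = s k i)
    (hv : ∀ i k, v i k = s i k • u i k) :
    hessian 𝔽 I l u v =
      ∑ i, ∑ k, s k i * (l i * signs I i + l k * signs I k) * ‖u k i‖ ^ 2 := by
  have h : hessian 𝔽 I l u v = 2 * ∑ i, ∑ k, l i * signs I i * (s k i * ‖u k i‖ ^ 2) := by
    rw [hessian_apply]
    simp only [hv, mul_smul_comm, map_smul, re_star_mul_self, smul_eq_mul]
  have h' : ∑ i, ∑ k, l i * signs I i * (s k i * ‖u k i‖ ^ 2) =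
      ∑ i, ∑ k, l k * signs I k * (s k i * ‖u k i‖ ^ 2) := by
    rw [Finset.sum_comm]
    refine Finset.sum_congr rfl fun i _ => Finset.sum_congr rfl fun k _ => ?_
    rw [hs, norm_apply_comm_of_mem_tangentSpace I hu]
  rw [h, two_mul]
  nth_rewrite 2 [h']
  simp only [← Finset.sum_add_distrib]
  exact Finset.sum_congr rfl fun _ _ => Finset.sum_congr rfl fun _ _ => by ring

theorem hessian_self_of_mem_tangentSpace (l : Fin n → ℝ) {u : Matrix (Fin n) (Fin n) 𝔽}
    (hu : u ∈ tangentSpace 𝔽 I) :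
    hessian 𝔽 I l u u = ∑ i, ∑ k, (l i * signs I i + l k * signs I k) * ‖u k i‖ ^ 2 := by
  simpa using hessian_smul_of_mem_tangentSpace I l hu (v := u) (s := fun _ _ => 1)
    (fun _ _ => rfl) (by simp)

variable {l : Fin n → ℝ}

theorem isCriticalPointOn_diagonal_signs (l : Fin n → ℝ) :
    IsCriticalPointOn (OrthSet 𝔽 n)
      (fun y => ‖y - Matrix.diagonal (fun i => algebraMap ℝ 𝔽 (l i))‖ ^ 2)
      (Matrix.diagonal (fun j => algebraMap ℝ 𝔽 (signs I j))) := by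
  refine ⟨diagonal_signs_mem_orthSet I, fun c hc hM h₀ => ?_⟩
  have hu : deriv c 0 ∈ tangentSpace 𝔽 I := by
    rw [← SetLike.mem_coe, ← tangentSetAt_diagonal_signs]
    exact ⟨c, hc, hM, h₀, rfl⟩
  rw [deriv_distSq_comp hc hM]
  simp [weightedTrace_apply, re_apply_self_of_mem_tangentSpace I hu]

theorem isNondegenerateCriticalPointOn_diagonal_signs (hpos : ∀ i, 0 < l i)
    (hmono : StrictMono l) :
    IsNondegenerateCriticalPointOn (OrthSet 𝔽 n)
      (fun y => ‖y - Matrix.diagonal (fun i => algebraMap ℝ 𝔽 (l i))‖ ^ 2)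
      (Matrix.diagonal (fun j => algebraMap ℝ 𝔽 (signs I j))) := by
  refine ⟨isCriticalPointOn_diagonal_signs I l, hessian 𝔽 I l, isHessianAt_hessian I l, ?_⟩
  rw [tangentSetAt_diagonal_signs]
  intro u hu h
  let w : Matrix (Fin n) (Fin n) 𝔽 := Matrix.of fun i k => signs I (max i k) • u i k
  have hwapp : ∀ i k, w i k = signs I (max i k) • u i k := fun _ _ => rfl
  have hw := h w fun i k => by
    rw [hwapp, hwapp, smul_comm, hu i k, star_smul,
      star_trivial (signs I (max k i)), smul_neg, max_comm, smul_comm]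
  rw [hessian_smul_of_mem_tangentSpace I l hu (s := fun i k => signs I (max i k))
    (fun i k => by rw [max_comm]) hwapp] at hw
  have hpos' := fun i k => signs_max_mul_pos I hpos hmono i k
  rw [Finset.sum_eq_zero_iff_of_nonneg fun i _ => Finset.sum_nonneg fun k _ =>
    mul_nonneg (hpos' i k).le (by positivity)] at hw
  ext k i
  have hi := hw i (Finset.mem_univ _)
  rw [Finset.sum_eq_zero_iff_of_nonneg fun k _ => mul_nonneg (hpos' i k).le (by positivity)] at hi
  simpa [(hpos' i k).ne'] using hi k (Finset.mem_univ _)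

/-- The tangent vectors supported at the entries `(k,i)` with `max k i ∈ I`. -/
def negativeSpace (𝔽 : Type*) [NormedRing 𝔽] [NormedAlgebra ℝ 𝔽] [StarRing 𝔽]
    [RealPartAlgebra 𝔽] {n : ℕ} (I : Finset (Fin n)) :
    Submodule ℝ (Matrix (Fin n) (Fin n) 𝔽) where
  carrier := {u | u ∈ tangentSpace 𝔽 I ∧ ∀ k i, max k i ∉ I → u k i = 0}
  add_mem' {u v} hu hv :=
    ⟨add_mem hu.1 hv.1, fun k i h => by rw [Matrix.add_apply, hu.2 k i h, hv.2 k i h, add_zero]⟩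
  zero_mem' := ⟨zero_mem _, fun _ _ _ => rfl⟩
  smul_mem' r u hu :=
    ⟨Submodule.smul_mem _ r hu.1, fun k i h => by rw [Matrix.smul_apply, hu.2 k i h, smul_zero]⟩

theorem hessian_self_neg (hpos : ∀ i, 0 < l i) (hmono : StrictMono l)
    {u : Matrix (Fin n) (Fin n) 𝔽} (hu : u ∈ negativeSpace 𝔽 I) (h0 : u ≠ 0) :
    hessian 𝔽 I l u u < 0 := by
  rw [hessian_self_of_mem_tangentSpace I l hu.1]
  have hneg : ∀ i k, max k i ∈ I → l i * signs I i + l k * signs I k < 0 := fun i k h => by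
    have := signs_max_mul_pos I hpos hmono i k
    rw [signs, if_pos h] at this
    linarith
  have hle : ∀ i k, (l i * signs I i + l k * signs I k) * ‖u k i‖ ^ 2 ≤ 0 := fun i k => by
    by_cases h : max k i ∈ I
    · exact mul_nonpos_of_nonpos_of_nonneg (hneg i k h).le (by positivity)
    · simp [hu.2 k i h]
  obtain ⟨k, i, hki⟩ : ∃ k i, u k i ≠ 0 := by
    by_contra! h
    exact h0 (Matrix.ext h)
  have hmem : max k i ∈ I := by
    by_contra h
    exact hki (hu.2 k i h)
  refine Finset.sum_neg' (fun i _ => Finset.sum_nonpos fun k _ => hle i k)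
    ⟨i, Finset.mem_univ _, Finset.sum_neg' (fun k _ => hle i k) ⟨k, Finset.mem_univ _, ?_⟩⟩
  exact mul_neg_of_neg_of_pos (hneg i k hmem) (by positivity)

theorem hessian_self_nonneg (hpos : ∀ i, 0 < l i) (hmono : StrictMono l)
    {u : Matrix (Fin n) (Fin n) 𝔽} (hu : u ∈ tangentSpace 𝔽 I)
    (hI : ∀ k i, max k i ∈ I → u k i = 0) : 0 ≤ hessian 𝔽 I l u u := by
  rw [hessian_self_of_mem_tangentSpace I l hu]
  refine Finset.sum_nonneg fun i _ => Finset.sum_nonneg fun k _ => ?_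
  by_cases h : max k i ∈ I
  · simp [hI k i h]
  · have := signs_max_mul_pos I hpos hmono i k
    rw [signs, if_neg h, one_mul] at this
    positivity

/-- The restriction of a matrix to the entries `(k,i)` with `max k i ∈ I`. -/
def restrictEntries (𝔽 : Type*) [NormedRing 𝔽] [NormedAlgebra ℝ 𝔽] {n : ℕ} (I : Finset (Fin n)) :
    Matrix (Fin n) (Fin n) 𝔽 →ₗ[ℝ] Matrix (Fin n) (Fin n) 𝔽 where
  toFun u := Matrix.of fun k i => if max k i ∈ I then u k i else 0
  map_add' u v := by ext k i; by_cases h : max k i ∈ I <;> simp [h]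
  map_smul' r u := by ext k i; by_cases h : max k i ∈ I <;> simp [h]

theorem restrictEntries_mem_negativeSpace {u : Matrix (Fin n) (Fin n) 𝔽}
    (hu : u ∈ tangentSpace 𝔽 I) : restrictEntries 𝔽 I u ∈ negativeSpace 𝔽 I := by
  refine ⟨fun k i => ?_, fun k i h => if_neg h⟩
  change signs I k • (if max k i ∈ I then u k i else 0) =
    -(signs I i • star (if max i k ∈ I then u i k else 0))
  rw [max_comm i k]
  split_ifs
  · exact hu k i
  · simp

theorem finrank_le_finrank_negativeSpace (hpos : ∀ i, 0 < l i) (hmono : StrictMono l)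
    {W : Submodule ℝ (Matrix (Fin n) (Fin n) 𝔽)} (hW : W ≤ tangentSpace 𝔽 I)
    (hneg : ∀ u ∈ W, u ≠ 0 → hessian 𝔽 I l u u < 0) :
    Module.finrank ℝ W ≤ Module.finrank ℝ (negativeSpace 𝔽 I) := by
  refine LinearMap.finrank_le_finrank_of_injective (f := (restrictEntries 𝔽 I).restrict
    fun u hu => restrictEntries_mem_negativeSpace I (hW hu)) ?_
  rw [← LinearMap.ker_eq_bot, LinearMap.ker_eq_bot']
  rintro ⟨u, hu⟩ h
  by_contra h0
  refine (hneg u hu fun h' => h0 (Subtype.ext h')).not_ge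
    (hessian_self_nonneg I hpos hmono (hW hu) fun k i hki => ?_)
  have : (if max k i ∈ I then u k i else 0) = 0 := congrFun (congrFun (congrArg Subtype.val h) k) i
  rwa [if_pos hki] at this

/-- The entries on and above the diagonal of the columns in `I` of a matrix in
`negativeSpace 𝔽 I`. -/
noncomputable def upperEntries (𝔽 : Type*) [NormedRing 𝔽] [NormedAlgebra ℝ 𝔽] [StarRing 𝔽]
    [RealPartAlgebra 𝔽] {n : ℕ} (I : Finset (Fin n)) :
    negativeSpace 𝔽 I →ₗ[ℝ]
      ((j : I) → ({k : Fin n // k < j} → 𝔽) × LinearMap.ker (re : 𝔽 →ₗ[ℝ] ℝ)) where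
  toFun u j := (fun k => u.1 k j, ⟨u.1 j j, re_apply_self_of_mem_tangentSpace I u.2.1 j⟩)
  map_add' _ _ := rfl
  map_smul' _ _ := rfl

theorem upperEntries_injective : Function.Injective (upperEntries 𝔽 I) := by
  rw [← LinearMap.ker_eq_bot, LinearMap.ker_eq_bot']
  rintro ⟨u, hu⟩ h
  have hle : ∀ k i, k ≤ i → u k i = 0 := by
    intro k i hki
    by_cases hi : i ∈ I
    · have := congrFun h ⟨i, hi⟩
      rcases hki.lt_or_eq with hlt | rfl
      · exact congrFun (congrArg Prod.fst this) ⟨k, hlt⟩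
      · exact congrArg Subtype.val (congrArg Prod.snd this)
    · exact hu.2 k i (by rwa [max_eq_right hki])
  refine Subtype.ext (Matrix.ext fun k i => ?_)
  rcases le_total k i with hki | hki
  · exact hle k i hki
  · have := norm_apply_comm_of_mem_tangentSpace I hu.1 k i
    rwa [hle i k hki, norm_zero, norm_eq_zero] at this

theorem upperEntries_surjective : Function.Surjective (upperEntries 𝔽 I) := by
  intro g
  let w : Fin n → Fin n → 𝔽 := fun k i =>
    if hi : i ∈ I then
      if hki : k < i then (g ⟨i, hi⟩).1 ⟨k, hki⟩
      else if k = i then (2⁻¹ : ℝ) • ((g ⟨i, hi⟩).2 : 𝔽) else 0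
    else 0
  have hw₀ : ∀ k i, i < k → w k i = 0 := fun k i h => by simp [w, h.not_gt, h.ne']
  have hwI : ∀ k i, max k i ∉ I → w k i = 0 := fun k i h => by
    rcases lt_or_ge i k with hik | hik
    · exact hw₀ k i hik
    · rw [max_eq_right hik] at h
      simp [w, h]
  let u : Matrix (Fin n) (Fin n) 𝔽 :=
    Matrix.of fun k i => w k i - (signs I k * signs I i) • star (w i k)
  have hu : ∀ k i, u k i = w k i - (signs I k * signs I i) • star (w i k) := fun _ _ => rfl
  have hmem : u ∈ negativeSpace 𝔽 I := by
    refine ⟨fun i j => ?_, fun k i h => ?_⟩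
    · rw [hu, hu, smul_sub, star_sub, star_smul, star_star, star_trivial (_ * _), smul_sub, smul_smul,
        smul_smul, ← mul_assoc, ← mul_assoc, signs_mul_self, signs_mul_self, one_mul, one_mul,
        neg_sub]
    · rw [hu, hwI k i h, hwI i k (by rwa [max_comm])]
      simp
  refine ⟨⟨u, hmem⟩, funext fun ⟨j, hj⟩ => Prod.ext (funext fun ⟨k, hk⟩ => ?_) (Subtype.ext ?_)⟩
  · change u k j = _
    rw [hu, hw₀ j k hk]
    simp [w, hj, hk]
  · change u j j = _
    have hstar : star ((g ⟨j, hj⟩).2 : 𝔽) = -((g ⟨j, hj⟩).2 : 𝔽) :=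
      eq_neg_of_add_eq_zero_right ((add_star_eq_zero_iff _).2 (g ⟨j, hj⟩).2.2)
    rw [hu, signs_mul_self]
    simp only [w, hj, lt_irrefl, dite_true, dite_false, if_true, star_smul, star_trivial, hstar]
    module

theorem finrank_negativeSpace : Module.finrank ℝ (negativeSpace 𝔽 I) =
    Module.finrank ℝ 𝔽 * (∑ j ∈ I, ((j : ℕ) + 1)) - I.card := by
  rw [(LinearEquiv.ofBijective _ ⟨upperEntries_injective (𝔽 := 𝔽) I,
    upperEntries_surjective I⟩).finrank_eq, Module.finrank_pi_fintype]
  refine Nat.eq_sub_of_add_eq ?_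
  have h : ∀ j : I, Module.finrank ℝ
      (({k : Fin n // k < j} → 𝔽) × LinearMap.ker (re : 𝔽 →ₗ[ℝ] ℝ)) + 1 =
      Module.finrank ℝ 𝔽 * ((j : Fin n) + 1) := fun j => by
    rw [Module.finrank_prod, Module.finrank_pi_fintype, add_assoc, finrank_ker_re]
    simp [Fintype.card_subtype, Finset.filter_gt_eq_Iio]
    ring
  rw [Finset.mul_sum, ← Finset.sum_coe_sort I, ← Finset.sum_congr rfl fun j _ => h j,
    Finset.sum_add_distrib]
  simp

theorem hasIndexAt_diagonal_signs (hpos : ∀ i, 0 < l i) (hmono : StrictMono l) :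
    HasIndexAt (OrthSet 𝔽 n)
      (fun y => ‖y - Matrix.diagonal (fun i => algebraMap ℝ 𝔽 (l i))‖ ^ 2)
      (Matrix.diagonal (fun j => algebraMap ℝ 𝔽 (signs I j)))
      (Module.finrank ℝ 𝔽 * (∑ j ∈ I, ((j : ℕ) + 1)) - I.card) := by
  refine ⟨hessian 𝔽 I l, isHessianAt_hessian I l, ⟨negativeSpace 𝔽 I, ?_,
    finrank_negativeSpace I, fun u hu h0 => hessian_self_neg I hpos hmono hu h0⟩, ?_⟩
  · rw [tangentSetAt_diagonal_signs]
    exact fun u hu => hu.1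
  · rw [tangentSetAt_diagonal_signs]
    intro W hW hneg
    rw [← finrank_negativeSpace (𝔽 := 𝔽) I]
    exact finrank_le_finrank_negativeSpace I hpos hmono hW hneg

end Signs

theorem orthMorseStatement (𝔽 : Type*) [NormedRing 𝔽] [NormedAlgebra ℝ 𝔽] [StarRing 𝔽]
    [RealPartAlgebra 𝔽] {n : ℕ} {l : Fin n → ℝ} (hpos : ∀ i, 0 < l i) (hmono : StrictMono l) :
    OrthMorseStatement 𝔽 (Module.finrank ℝ 𝔽) n (algebraMap ℝ 𝔽) l := by
  refine ⟨fun x hx => ?_, Set.Subset.antisymm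
    (fun x hx => exists_signs_of_isCriticalPointOn hpos hmono.injective hx) ?_, fun I => ?_⟩
  · obtain ⟨I, rfl⟩ := exists_signs_of_isCriticalPointOn hpos hmono.injective hx
    rw [← diagonal_signs]
    exact isNondegenerateCriticalPointOn_diagonal_signs I hpos hmono
  · rintro _ ⟨I, rfl⟩
    rw [← diagonal_signs]
    exact isCriticalPointOn_diagonal_signs I l
  · rw [← diagonal_signs]
    exact hasIndexAt_diagonal_signs I hpos hmono

end RealPartAlgebra

/-- For `𝔽 = ℝ, ℂ, ℍ`, `0 < λ₁ < ⋯ < λ_n` and `a = diag(λ₁,…,λ_n)`,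
the function `f_a(x) = ‖x − a‖²` is a Morse function on `O(n;𝔽)` whose critical points are
exactly the `σ_I`, and the index of `σ_{i₁,…,i_r}` is `dim_ℝ𝔽·(i₁ + ⋯ + i_r) − r`. -/
theorem orthSet_distSq_isMorse (n : ℕ) (l : Fin n → ℝ)
    (hpos : ∀ i, 0 < l i) (hmono : StrictMono l) :
    OrthMorseStatement ℝ 1 n (fun r => r) l ∧
    OrthMorseStatement ℂ 2 n (fun r => (r : ℂ)) l ∧
    OrthMorseStatement ℍ[ℝ] 4 n (fun r => (r : ℍ[ℝ])) l := by
  refine ⟨?_, ?_, ?_⟩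
  · have h := RealPartAlgebra.orthMorseStatement ℝ hpos hmono
    rwa [Module.finrank_self] at h
  · have h := RealPartAlgebra.orthMorseStatement ℂ hpos hmono
    rwa [Complex.finrank_real_complex] at h
  · have h := RealPartAlgebra.orthMorseStatement ℍ[ℝ] hpos hmono
    rwa [Quaternion.finrank_eq_four] at h
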